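/- For natural numbers s ≥ 1 and n ≥ 1 and every real number x with |x| < 1, the n-th Meyer-König and Zeller operator applied to the function g_s(t) = (1-t)^s satisfies (M_n g_s)(x) = (n^s / n!) · (1-x)^{n+1} · Li_s^{(n)}(x), where Li_s^{(n)} denotes the n-th derivative of the polylogarithm Li_s. -/

import Mathlib

/-- The Meyer-König and Zeller operator. -/
noncomputable def MKZ (n : ℕ) (f : ℝ → ℝ) (x : ℝ) : ℝ :=
  (1 - x) ^ (n + 1) *
    ∑' ν : ℕ, (Nat.choose (ν + n) ν : ℝ) * f ((ν : ℝ) / ((ν : ℝ) + (n : ℝ))) * x ^ ν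

/-- The polylogarithm Li_s(x) = Σ_{ν≥1} x^ν / ν^s. -/
noncomputable def Li (s : ℕ) (x : ℝ) : ℝ :=
  ∑' ν : ℕ, x ^ (ν + 1) / ((ν : ℝ) + 1) ^ s

/-- A power series with coefficients bounded by `1` can be differentiated termwise any number of
times inside the unit interval. -/
theorem iteratedDeriv_tsum_mul_pow {b : ℕ → ℝ} (hb : ∀ k, |b k| ≤ 1) (k : ℕ) {x : ℝ}
    (hx : |x| < 1) :
    iteratedDeriv k (fun y => ∑' ν : ℕ, b ν * y ^ ν) x =
      ∑' ν : ℕ, ((ν + k).descFactorial k : ℝ) * b (ν + k) * x ^ ν := by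
  induction k generalizing x with
  | zero => simp
  | succ k ih =>
    rw [iteratedDeriv_succ]
    have hev : iteratedDeriv k (fun y => ∑' ν : ℕ, b ν * y ^ ν) =ᶠ[nhds x]
        fun y => ∑' ν : ℕ, ((ν + k).descFactorial k : ℝ) * b (ν + k) * y ^ ν := by
      filter_upwards [(isOpen_lt continuous_abs continuous_const).mem_nhds hx] with y hy
      exact ih hy
    rw [hev.deriv_eq]
    obtain ⟨r, hxr, hr1⟩ := exists_between hx
    have hr0 : 0 ≤ r := (abs_nonneg x).trans hxr.le
    have hdesc (ν : ℕ) : ((ν + (k + 1)).descFactorial (k + 1) : ℝ) =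
        ((ν + 1 : ℕ) : ℝ) * ((ν + 1 + k).descFactorial k : ℝ) := by
      rw [Nat.descFactorial_succ, show ν + (k + 1) - k = ν + 1 by lia,
        show ν + (k + 1) = ν + 1 + k by lia, Nat.cast_mul]
    have hu : Summable fun ν : ℕ => ((ν + k).descFactorial k : ℝ) * (ν * r ^ (ν - 1)) := by
      rw [← summable_nat_add_iff 1]
      refine (summable_descFactorial_mul_geometric_of_norm_lt_one (k + 1)
        (r := r) (by rwa [Real.norm_of_nonneg hr0])).congr fun ν => ?_
      rw [hdesc, Nat.add_sub_cancel]
      ring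
    have hbound (ν : ℕ) (y : ℝ) (hy : y ∈ Metric.ball (0 : ℝ) r) :
        ‖((ν + k).descFactorial k : ℝ) * b (ν + k) * (ν * y ^ (ν - 1))‖ ≤
          ((ν + k).descFactorial k : ℝ) * (ν * r ^ (ν - 1)) := by
      have hyr : |y| ≤ r := by simpa using (mem_ball_zero_iff.mp hy).le
      simp only [norm_mul, norm_pow, Real.norm_eq_abs, Nat.abs_cast]
      have h1 := mul_le_of_le_one_right (Nat.cast_nonneg (α := ℝ) ((ν + k).descFactorial k))
        (hb (ν + k))
      gcongr
    have h0 : (0 : ℝ) ∈ Metric.ball (0 : ℝ) r :=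
      Metric.mem_ball_self ((abs_nonneg x).trans_lt hxr)
    have hsum0 : Summable fun ν : ℕ =>
        ((ν + k).descFactorial k : ℝ) * b (ν + k) * (0 : ℝ) ^ ν :=
      summable_of_ne_finset_zero (s := {0}) fun ν hν => by
        simp [zero_pow (show ν ≠ 0 by simpa using hν)]
    have hderiv := hasDerivAt_tsum_of_isPreconnected hu Metric.isOpen_ball
      (convex_ball (0 : ℝ) r).isPreconnected
      (fun ν y _ => (hasDerivAt_pow ν y).const_mul _) hbound h0 hsum0
      (y := x) (by simpa using hxr)
    rw [hderiv.deriv, (hu.of_norm_bounded fun ν =>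
      hbound ν x (by simpa using hxr)).tsum_eq_zero_add]
    simp only [Nat.cast_zero, zero_mul, mul_zero, zero_add]
    refine tsum_congr fun ν => ?_
    rw [hdesc, Nat.add_sub_cancel, show ν + (k + 1) = ν + 1 + k by lia]
    ring

/-- `Li` as a power series with vanishing constant coefficient. -/
theorem Li_eq_tsum {s : ℕ} (hs : s ≠ 0) (x : ℝ) :
    Li s x = ∑' ν : ℕ, ((ν : ℝ) ^ s)⁻¹ * x ^ ν := by
  have hsupp : Function.support (fun ν : ℕ => ((ν : ℝ) ^ s)⁻¹ * x ^ ν) ⊆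
      Set.range Nat.succ := by
    intro ν hν
    cases ν with
    | zero => simp [hs] at hν
    | succ m => exact ⟨m, rfl⟩
  rw [Li, ← Nat.succ_injective.tsum_eq hsupp]
  refine tsum_congr fun ν => ?_
  rw [Nat.succ_eq_add_one]
  push_cast
  ring

theorem mkz_g_s(s n : ℕ) (hs : 1 ≤ s) (hn : 1 ≤ n) (x : ℝ) (hx : |x| < 1) :
    MKZ n (fun t => (1 - t) ^ s) x =
      ((n : ℝ) ^ s / (Nat.factorial n : ℝ)) * (1 - x) ^ (n + 1) *
        iteratedDeriv n (Li s) x := by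
  have hb (k : ℕ) : |((k : ℝ) ^ s)⁻¹| ≤ 1 := by
    rcases k.eq_zero_or_pos with rfl | hk
    · simp [show s ≠ 0 by lia]
    · rw [abs_of_nonneg (by positivity)]
      exact inv_le_one_of_one_le₀ (one_le_pow₀ (by exact_mod_cast hk))
  rw [show Li s = _ from funext (Li_eq_tsum (by lia)), iteratedDeriv_tsum_mul_pow hb n hx, MKZ,
    mul_comm ((n : ℝ) ^ s / _), mul_assoc]
  congr 1
  rw [← tsum_mul_left]
  refine tsum_congr fun ν => ?_
  have hn' : (n : ℝ) ≠ 0 := by positivity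
  have hνn : (ν : ℝ) + n ≠ 0 := by positivity
  have hfac : (n.factorial : ℝ) ≠ 0 := by positivity
  rw [Nat.choose_symm_add, Nat.descFactorial_eq_factorial_mul_choose,
    show 1 - (ν : ℝ) / (ν + n) = n / (ν + n) by field_simp; ring, div_pow]
  push_cast
  field_simp
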